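/- Assume X has full row rank and λ := λ_max²(X Σ⁻¹ Xᵀ) < 1, and set L = n(1+λ). Then: (a) for every z ∈ ℝⁿ, ∫_{ℝⁿ} V̌₂(z') ǩ_AC(z,z') dz' ≤ λ V̌₂(z) + L; and (b) for every d > 2L/(1−λ) there exists a probability density q on ℝⁿ such that ǩ_AC(z,z') ≥ 2^{−n/2} e^{−d} q(z') for all z' and all z with V̌₂(z) ≤ d. -/

import Mathlib

open MeasureTheory Matrix Filter

noncomputable section

/-- standard normal pdf -/
def nphi (x : ℝ) : ℝ := (Real.sqrt (2 * Real.pi))⁻¹ * Real.exp (-(x ^ 2) / 2)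

/-- standard normal cdf -/
def nPhi (x : ℝ) : ℝ := ∫ t in Set.Iic x, nphi t

/-- density of TN(θ,1;1) (if b = true) resp. TN(θ,1;0) (if b = false) at z -/
def tn (θ : ℝ) (b : Bool) (z : ℝ) : ℝ :=
  if b then (if 0 < z then nphi (z - θ) / nPhi θ else 0)
  else (if z < 0 then nphi (z - θ) / (1 - nPhi θ) else 0)

/-- p-variate Gaussian density with mean μ and covariance matrix Λ -/
def mvn {p : ℕ} (μ : Fin p → ℝ) (Λ : Matrix (Fin p) (Fin p) ℝ) (x : Fin p → ℝ) : ℝ :=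
  Real.sqrt (((2 * Real.pi) ^ p * Λ.det)⁻¹) *
    Real.exp (-(dotProduct (x - μ) (Λ⁻¹.mulVec (x - μ))) / 2)

/-- squared Euclidean norm -/
def normSq {m : ℕ} (x : Fin m → ℝ) : ℝ := ∑ i, x i ^ 2

/-- Albert and Chib's Markov transition density, with Σ = XᵀX + Q -/
def kAC {n p : ℕ} (X : Matrix (Fin n) (Fin p) ℝ) (Y : Fin n → Bool)
    (v : Fin p → ℝ) (Q : Matrix (Fin p) (Fin p) ℝ) (β β' : Fin p → ℝ) : ℝ :=
  ∫ z : Fin n → ℝ,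
    mvn ((Xᵀ * X + Q)⁻¹.mulVec (Xᵀ.mulVec z + Q.mulVec v)) (Xᵀ * X + Q)⁻¹ β' *
      ∏ i, tn (dotProduct (X i) β) (Y i) (z i)

/-- the defining property of the posterior mode B̂ -/
def IsPosteriorMode {n p : ℕ} (X : Matrix (Fin n) (Fin p) ℝ) (Y : Fin n → Bool)
    (v : Fin p → ℝ) (Q : Matrix (Fin p) (Fin p) ℝ) (Bhat : Fin p → ℝ) : Prop :=
  (∑ i, (if Y i then nphi (dotProduct (X i) Bhat) / nPhi (dotProduct (X i) Bhat)
          else -(nphi (dotProduct (X i) Bhat) / (1 - nPhi (dotProduct (X i) Bhat)))) • X i)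
    - Q.mulVec (Bhat - v) = 0

/-- largest eigenvalue of a symmetric real matrix, as the supremum of the
Rayleigh quotient -/
def lmax {m : ℕ} (M : Matrix (Fin m) (Fin m) ℝ) : ℝ :=
  sSup {r : ℝ | ∃ x : Fin m → ℝ, x ≠ 0 ∧ r = dotProduct x (M.mulVec x) / normSq x}

/-- the flipped transition density ǩ_AC on ℝⁿ -/
def kACflip {n p : ℕ} (X : Matrix (Fin n) (Fin p) ℝ) (Y : Fin n → Bool)
    (v : Fin p → ℝ) (Q : Matrix (Fin p) (Fin p) ℝ) (z z' : Fin n → ℝ) : ℝ :=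
  ∫ β : Fin p → ℝ,
    (∏ i, tn (dotProduct (X i) β) (Y i) (z' i)) *
      mvn ((Xᵀ * X + Q)⁻¹.mulVec (Xᵀ.mulVec z + Q.mulVec v)) (Xᵀ * X + Q)⁻¹ β

/-- w(z) = (XΣ⁻¹Xᵀ)^{-1/2} X (Σ⁻¹(Xᵀz+Qv) − B̂); here `R` is (XΣ⁻¹Xᵀ)^{-1/2} -/
def wfun {n p : ℕ} (X : Matrix (Fin n) (Fin p) ℝ) (v : Fin p → ℝ)
    (Q : Matrix (Fin p) (Fin p) ℝ) (R : Matrix (Fin n) (Fin n) ℝ)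
    (Bhat : Fin p → ℝ) (z : Fin n → ℝ) : Fin n → ℝ :=
  R.mulVec (X.mulVec ((Xᵀ * X + Q)⁻¹.mulVec (Xᵀ.mulVec z + Q.mulVec v) - Bhat))

set_option linter.unusedSimpArgs false

/-! ### One-dimensional facts -/

lemma nphi_eq_gauss (x : ℝ) : nphi x = ProbabilityTheory.gaussianPDFReal 0 1 x := by
  simp [nphi, ProbabilityTheory.gaussianPDFReal]

lemma nphi_pos (x : ℝ) : 0 < nphi x := by
  unfold nphi; positivity

lemma nphi_cont : Continuous nphi := by
  unfold nphi; fun_prop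

lemma nphi_neg (x : ℝ) : nphi (-x) = nphi x := by
  simp [nphi]

lemma nphi_int : Integrable nphi := by
  have := ProbabilityTheory.integrable_gaussianPDFReal 0 1
  exact this.congr (Eventually.of_forall fun x => (nphi_eq_gauss x).symm)

lemma nphi_integral : ∫ x, nphi x = 1 := by
  simp_rw [nphi_eq_gauss]
  exact ProbabilityTheory.integral_gaussianPDFReal_eq_one 0 one_ne_zero

lemma nphi_int1 : Integrable (fun x => x * nphi x) := by
  have := (integrable_mul_exp_neg_mul_sq (b := 1/2) (by norm_num)).const_mul (Real.sqrt (2 * Real.pi))⁻¹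
  refine this.congr (Eventually.of_forall fun x => ?_)
  simp only [nphi]
  rw [show -(1/2:ℝ) * x^2 = -(x^2)/2 by ring]; ring

lemma nphi_int2 : Integrable (fun x => x ^ 2 * nphi x) := by
  have := (integrable_rpow_mul_exp_neg_mul_sq (b := 1/2) (by norm_num) (s := 2) (by norm_num)).const_mul
    (Real.sqrt (2 * Real.pi))⁻¹
  refine this.congr (Eventually.of_forall fun x => ?_)
  simp only [nphi, Real.rpow_two]
  rw [show -(1/2:ℝ) * x^2 = -(x^2)/2 by ring]; ring

lemma nphi_deriv (x : ℝ) : HasDerivAt nphi (-(x * nphi x)) x := by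
  unfold nphi
  have h : HasDerivAt (fun y : ℝ => -(y^2)/2) (-x) x := by
    have := ((hasDerivAt_pow 2 x).neg).div_const 2
    exact this.congr_deriv (by simp; ring)
  exact ((h.exp).const_mul (Real.sqrt (2 * Real.pi))⁻¹).congr_deriv (by ring)

lemma nphi_top : Tendsto nphi atTop (nhds 0) := by
  have h : Tendsto (fun x : ℝ => -(x^2)/2) atTop atBot := by
    have := (tendsto_pow_atTop (α := ℝ) (n := 2) (by norm_num))
    have := (tendsto_neg_atTop_atBot.comp this)
    exact this.atBot_div_const (by norm_num)
  have := (Real.tendsto_exp_atBot.comp h).const_mul (Real.sqrt (2 * Real.pi))⁻¹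
  rw [mul_zero] at this
  exact this

lemma mul_nphi_top : Tendsto (fun x => x * nphi x) atTop (nhds 0) := by
  have h := (rpow_mul_exp_neg_mul_sq_isLittleO_exp_neg (b := 1/2) (by norm_num) 1)
  have h2 : Tendsto (fun x : ℝ => Real.exp (-(1/2) * x)) atTop (nhds 0) := by
    apply Real.tendsto_exp_atBot.comp
    exact tendsto_id.const_mul_atTop_of_neg (by norm_num)
  have h3 := (h.trans_tendsto h2).const_mul (Real.sqrt (2 * Real.pi))⁻¹
  rw [mul_zero] at h3
  refine h3.congr fun x => ?_
  simp only [nphi, Real.rpow_one]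
  rw [show -(1/2:ℝ) * x^2 = -(x^2)/2 by ring]; ring

lemma nphi_integral2 : ∫ x, x ^ 2 * nphi x = 1 := by
  have hd : ∀ x, HasDerivAt (fun x => -(x * nphi x)) (x ^ 2 * nphi x - nphi x) x := by
    intro x
    exact ((hasDerivAt_id x).mul (nphi_deriv x)).neg.congr_deriv (by simp; ring)
  have hb : Tendsto (fun x => -(x * nphi x)) atBot (nhds 0) := by
    have := mul_nphi_top.comp tendsto_neg_atBot_atTop
    refine this.congr fun x => ?_
    simp [nphi_neg]
  have := integral_of_hasDerivAt_of_tendsto hd (nphi_int2.sub nphi_int) hb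
    (by simpa using mul_nphi_top.neg)
  rw [integral_sub nphi_int2 nphi_int, nphi_integral] at this
  linarith

lemma nphi_integral1 : ∫ x, x * nphi x = 0 := by
  have h := integral_neg_eq_self (fun x => x * nphi x) volume
  simp only [nphi_neg, neg_mul, integral_neg] at h
  linarith

lemma nPhi_pos (x : ℝ) : 0 < nPhi x := by
  unfold nPhi
  rw [setIntegral_pos_iff_support_of_nonneg_ae]
  · have : Function.support nphi = Set.univ := by
      ext y; simp [(nphi_pos y).ne']
    simp [this]
  · exact Eventually.of_forall fun y => (nphi_pos y).le
  · exact nphi_int.integrableOn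

lemma nPhi_neg (x : ℝ) : 1 - nPhi x = nPhi (-x) := by
  have h1 := integral_add_compl (s := Set.Iic x) measurableSet_Iic nphi_int
  have h2 := integral_comp_neg_Iic (-x) nphi
  simp only [nphi_neg, neg_neg] at h2
  rw [Set.compl_Iic, nphi_integral] at h1
  unfold nPhi
  rw [h2]; linarith

lemma nPhi_deriv (x : ℝ) : HasDerivAt nPhi (nphi x) x := by
  have h : nPhi = fun u => nPhi 0 + ∫ t in (0:ℝ)..u, nphi t := by
    funext u
    rw [← intervalIntegral.integral_Iic_sub_Iic nphi_int.integrableOn nphi_int.integrableOn]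
    simp [nPhi]
  rw [h]
  exact (intervalIntegral.integral_hasDerivAt_right (nphi_cont.intervalIntegrable _ _)
    (nphi_cont.stronglyMeasurableAtFilter _ _) nphi_cont.continuousAt).const_add _

lemma nPhi_cont : Continuous nPhi :=
  continuous_iff_continuousAt.2 fun x => (nPhi_deriv x).continuousAt

lemma nPhi_mono : Monotone nPhi := by
  intro x y h
  exact setIntegral_mono_set nphi_int.integrableOn
    (Eventually.of_forall fun y => (nphi_pos y).le) (Set.Iic_subset_Iic.2 h).eventuallyLE

lemma shift_int (θ : ℝ) : Integrable (fun z => nphi (z - θ)) :=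
  nphi_int.comp_sub_right θ

lemma shift_int1 (θ : ℝ) : Integrable (fun z => (z - θ) * nphi (z - θ)) :=
  nphi_int1.comp_sub_right θ

lemma shift_int2 (θ c : ℝ) : Integrable (fun z => (z - c) ^ 2 * nphi (z - θ)) := by
  have h := ((nphi_int2.comp_sub_right θ).add ((shift_int1 θ).const_mul (2 * (θ - c)))).add
    ((shift_int θ).const_mul ((θ - c)^2))
  refine h.congr (Eventually.of_forall fun z => ?_)
  simp only [Pi.add_apply]; ring

lemma shift_int1c (θ c : ℝ) : Integrable (fun z => (z - c) * nphi (z - θ)) := by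
  have h := (shift_int1 θ).add ((shift_int θ).const_mul (θ - c))
  refine h.congr (Eventually.of_forall fun z => ?_)
  simp only [Pi.add_apply]; ring

lemma half0 (θ : ℝ) : ∫ z in Set.Ioi 0, nphi (z - θ) = nPhi θ := by
  have h := integral_comp_neg_Iic 0 (fun z => nphi (z - θ))
  rw [neg_zero] at h
  rw [← h, nPhi]
  rw [← integral_indicator measurableSet_Iic, ← integral_indicator measurableSet_Iic,
    ← integral_sub_right_eq_self _ θ]
  congr 1; funext z
  by_cases hz : z ≤ θ
  · rw [Set.indicator_of_mem, Set.indicator_of_mem]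
    · rw [← nphi_neg]; congr 1; ring
    · exact hz
    · simpa using hz
  · rw [Set.indicator_of_notMem, Set.indicator_of_notMem]
    · exact hz
    · simpa using hz

lemma tend_shift (θ : ℝ) : Tendsto (fun z : ℝ => z - θ) atTop atTop :=
  tendsto_atTop_add_const_right _ (-θ) tendsto_id

lemma half1 (θ : ℝ) : ∫ z in Set.Ioi 0, (z - θ) * nphi (z - θ) = nphi θ := by
  have hd : ∀ z, HasDerivAt (fun z => - nphi (z - θ)) ((z - θ) * nphi (z - θ)) z := by
    intro z
    have := ((nphi_deriv (z - θ)).comp z ((hasDerivAt_id z).sub_const θ)).neg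
    exact this.congr_deriv (by simp)
  have ht : Tendsto (fun z => - nphi (z - θ)) atTop (nhds 0) := by
    simpa using (nphi_top.comp (tend_shift θ)).neg
  rw [integral_Ioi_of_hasDerivAt_of_tendsto (hd 0).continuousAt.continuousWithinAt
    (fun z _ => hd z) (shift_int1 θ).integrableOn ht]
  simp [nphi_neg]

lemma half2 (θ : ℝ) : ∫ z in Set.Ioi 0, (z - θ) ^ 2 * nphi (z - θ) = nPhi θ - θ * nphi θ := by
  have hd : ∀ z, HasDerivAt (fun z => - ((z - θ) * nphi (z - θ)))
      ((z - θ) ^ 2 * nphi (z - θ) - nphi (z - θ)) z := by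
    intro z
    have h1 := (hasDerivAt_id z).sub_const θ
    have := (h1.mul ((nphi_deriv (z - θ)).comp z h1)).neg
    exact this.congr_deriv (by simp; ring)
  have ht : Tendsto (fun z => - ((z - θ) * nphi (z - θ))) atTop (nhds 0) := by
    simpa using (mul_nphi_top.comp (tend_shift θ)).neg
  have := integral_Ioi_of_hasDerivAt_of_tendsto (hd 0).continuousAt.continuousWithinAt
    (fun z _ => hd z) ((shift_int2 θ θ).sub (shift_int θ)).integrableOn ht
  rw [integral_sub (shift_int2 θ θ).integrableOn (shift_int θ).integrableOn, half0] at this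
  simp [nphi_neg] at this
  linarith

/-- the inverse Mills ratio -/
def mills (θ : ℝ) : ℝ := nphi θ / nPhi θ

lemma mills_pos (θ : ℝ) : 0 < mills θ := div_pos (nphi_pos _) (nPhi_pos _)

lemma tn_true (θ z : ℝ) :
    tn θ true z = Set.indicator (Set.Ioi 0) (fun z => nphi (z - θ) / nPhi θ) z := by
  simp [tn, Set.indicator]

lemma tn_false (θ z : ℝ) : tn θ false z = tn (-θ) true (-z) := by
  simp only [tn, Bool.false_eq_true, if_false, if_true, nPhi_neg, Left.neg_pos_iff]
  congr 2
  rw [← nphi_neg]; congr 1; ring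

lemma tn_mul_integrable (θ : ℝ) (h : ℝ → ℝ) (hi : Integrable fun z => h z * nphi (z - θ)) :
    Integrable fun z => h z * tn θ true z := by
  have := (hi.div_const (nPhi θ)).indicator (measurableSet_Ioi (a := (0:ℝ)))
  refine this.congr (Eventually.of_forall fun z => ?_)
  by_cases hz : 0 < z <;> simp [tn, Set.indicator, hz, mul_div_assoc]

lemma tn_mul_integral (θ : ℝ) (h : ℝ → ℝ) :
    ∫ z, h z * tn θ true z = (∫ z in Set.Ioi 0, h z * nphi (z - θ)) / nPhi θ := by
  rw [← integral_div, ← integral_indicator measurableSet_Ioi]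
  congr 1; funext z
  by_cases hz : 0 < z <;> simp [tn, Set.indicator, hz, mul_div_assoc]

lemma tn_nonneg (θ : ℝ) (b : Bool) (z : ℝ) : 0 ≤ tn θ b z := by
  have h : ∀ θ z, 0 ≤ tn θ true z := by
    intro θ z
    rw [tn_true]
    exact Set.indicator_nonneg (fun z _ => div_nonneg (nphi_pos _).le (nPhi_pos _).le) _
  cases b
  · rw [tn_false]; exact h _ _
  · exact h _ _

/-- the mean of the truncated normal -/
def emn (θ : ℝ) (b : Bool) : ℝ := if b then θ + mills θ else -(-θ + mills (-θ))

lemma tnt_int0 (θ : ℝ) : Integrable (tn θ true) := by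
  simpa using tn_mul_integrable θ (fun _ => 1) (by simpa using shift_int θ)

lemma tnt_integral0 (θ : ℝ) : ∫ z, tn θ true z = 1 := by
  have := tn_mul_integral θ (fun _ => 1)
  simp only [one_mul, half0] at this
  rw [this, div_self (nPhi_pos θ).ne']

lemma tnt_int1 (θ c : ℝ) : Integrable (fun z => (z - c) * tn θ true z) :=
  tn_mul_integrable θ (fun z => z - c) (shift_int1c θ c)

lemma tnt_integral1 (θ c : ℝ) : ∫ z, (z - c) * tn θ true z = θ + mills θ - c := by
  rw [tn_mul_integral θ (fun z => z - c)]
  have : ∀ z, (z - c) * nphi (z - θ) = (z - θ) * nphi (z - θ) + (θ - c) * nphi (z - θ) := by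
    intro z; ring
  simp_rw [this]
  rw [integral_add (shift_int1 θ).integrableOn ((shift_int θ).const_mul _).integrableOn,
    integral_const_mul, half0, half1]
  have := (nPhi_pos θ).ne'
  unfold mills; field_simp; ring

lemma tnt_int2 (θ c : ℝ) : Integrable (fun z => (z - c) ^ 2 * tn θ true z) :=
  tn_mul_integrable θ (fun z => (z - c) ^ 2) (shift_int2 θ c)

lemma tnt_integral2 (θ c : ℝ) : ∫ z, (z - c) ^ 2 * tn θ true z
    = 1 - mills θ * (θ + mills θ) + (θ + mills θ - c) ^ 2 := by
  rw [tn_mul_integral θ (fun z => (z - c) ^ 2)]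
  have : ∀ z, (z - c) ^ 2 * nphi (z - θ) = (z - θ) ^ 2 * nphi (z - θ)
      + ((2 * (θ - c)) * ((z - θ) * nphi (z - θ)) + (θ - c) ^ 2 * nphi (z - θ)) := by
    intro z; ring
  simp_rw [this]
  have hI : ∀ a b : ℝ, Integrable (fun z => a * ((z - θ) * nphi (z - θ)) + b * nphi (z - θ)) :=
    fun a b => ((shift_int1 θ).const_mul _).add ((shift_int θ).const_mul _)
  rw [integral_add (shift_int2 θ θ).integrableOn
      (hI _ _).integrableOn,
    integral_add ((shift_int1 θ).const_mul _).integrableOn ((shift_int θ).const_mul _).integrableOn,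
    integral_const_mul, integral_const_mul, half0, half1, half2]
  have := (nPhi_pos θ).ne'
  unfold mills; field_simp; ring

lemma mean_nonneg (θ : ℝ) : 0 ≤ θ + mills θ := by
  have h := tnt_integral1 θ 0
  rw [sub_zero] at h
  rw [← h]
  refine integral_nonneg fun z => ?_
  by_cases hz : 0 < z
  · exact mul_nonneg (by simpa using hz.le) (tn_nonneg _ _ _)
  · simp [tn, hz]

lemma var_nonneg (θ : ℝ) : 0 ≤ 1 - mills θ * (θ + mills θ) := by
  have h := tnt_integral2 θ (θ + mills θ)
  rw [sub_self, zero_pow two_ne_zero, add_zero] at h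
  rw [← h]
  exact integral_nonneg fun z => mul_nonneg (sq_nonneg _) (tn_nonneg _ _ _)

lemma mean_deriv (θ : ℝ) :
    HasDerivAt (fun θ => θ + mills θ) (1 - mills θ * (θ + mills θ)) θ := by
  have h := (hasDerivAt_id θ).add ((nphi_deriv θ).div (nPhi_deriv θ) (nPhi_pos θ).ne')
  refine h.congr_deriv ?_
  have := (nPhi_pos θ).ne'
  unfold mills; field_simp; ring

lemma mean_lip (a b : ℝ) : |(a + mills a) - (b + mills b)| ≤ |a - b| := by
  have := Convex.norm_image_sub_le_of_norm_deriv_le (f := fun θ => θ + mills θ) (s := Set.univ)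
    (x := b) (y := a) (C := 1) (fun x _ => (mean_deriv x).differentiableAt)
    (fun x _ => by
      rw [(mean_deriv x).deriv, Real.norm_eq_abs, abs_of_nonneg (var_nonneg x)]
      have := mul_nonneg (mills_pos x).le (mean_nonneg x)
      linarith) convex_univ trivial trivial
  simpa using this

lemma em_lip (a b : ℝ) (y : Bool) : |emn a y - emn b y| ≤ |a - b| := by
  cases y
  · have := mean_lip (-b) (-a)
    simp only [emn, Bool.false_eq_true, if_false]
    rw [show -(-a + mills (-a)) - -(-b + mills (-b))
      = (-b + mills (-b)) - (-a + mills (-a)) by ring, show a - b = -b - -a by ring]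
    exact this
  · simp only [emn, if_true]; exact mean_lip a b

lemma tn_moments (θ : ℝ) (b : Bool) (c : ℝ) :
    Integrable (tn θ b) ∧ ∫ z, tn θ b z = 1 ∧
    Integrable (fun z => (z - c) * tn θ b z) ∧ ∫ z, (z - c) * tn θ b z = emn θ b - c ∧
    Integrable (fun z => (z - c) ^ 2 * tn θ b z) ∧
    ∫ z, (z - c) ^ 2 * tn θ b z ≤ 1 + (emn θ b - c) ^ 2 := by
  cases b
  · have e : tn θ false = fun z => tn (-θ) true (-z) := funext fun z => tn_false θ z
    have e1 : (fun z => (z - c) * tn θ false z)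
        = fun z => (fun z => -((z - -c) * tn (-θ) true z)) (-z) := by
      funext z; simp only [tn_false]; ring
    have e2 : (fun z => (z - c) ^ 2 * tn θ false z)
        = fun z => (fun z => ((z - -c) ^ 2 * tn (-θ) true z)) (-z) := by
      funext z; simp only [tn_false]; ring
    refine ⟨?_, ?_, ?_, ?_, ?_, ?_⟩
    · rw [e]; exact (tnt_int0 (-θ)).comp_neg
    · rw [e, integral_neg_eq_self (fun z => tn (-θ) true z)]; exact tnt_integral0 _
    · rw [e1]; exact (tnt_int1 (-θ) (-c)).neg.comp_neg
    · rw [e1, integral_neg_eq_self (fun z => -((z - -c) * tn (-θ) true z)), integral_neg,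
        tnt_integral1]
      simp [emn]; ring
    · rw [e2]; exact (tnt_int2 (-θ) (-c)).comp_neg
    · rw [e2, integral_neg_eq_self (fun z => ((z - -c) ^ 2 * tn (-θ) true z)),
        tnt_integral2]
      have := mul_nonneg (mills_pos (-θ)).le (mean_nonneg (-θ))
      simp only [emn, Bool.false_eq_true, if_false]
      nlinarith
  · refine ⟨tnt_int0 θ, tnt_integral0 θ, tnt_int1 θ c, ?_, tnt_int2 θ c, ?_⟩
    · rw [tnt_integral1]; simp [emn]
    · rw [tnt_integral2]
      have := mul_nonneg (mills_pos θ).le (mean_nonneg θ)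
      simp only [emn, if_true]
      linarith

lemma mills_le (θ : ℝ) : mills θ ≤ |θ| + 1 := by
  by_contra! h
  have h1 := var_nonneg θ
  have h2 := neg_abs_le θ
  have h3 := abs_nonneg θ
  nlinarith

lemma tnt_bdd (z : ℝ) : ∃ C, ∀ θ, tn θ true z ≤ C := by
  by_cases hz : 0 < z
  · refine ⟨1 + 1 / z + (Real.sqrt (2 * Real.pi))⁻¹ / nPhi 0, fun θ => ?_⟩
    have hs : 0 < (Real.sqrt (2 * Real.pi))⁻¹ := by positivity
    have hP := nPhi_pos 0
    have e : tn θ true z = nphi (z - θ) / nPhi θ := by simp [tn, hz]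
    rw [e]
    by_cases hθ : 0 ≤ θ
    · have h1 : nphi (z - θ) ≤ (Real.sqrt (2 * Real.pi))⁻¹ := by
        unfold nphi
        apply mul_le_of_le_one_right hs.le
        rw [Real.exp_le_one_iff]; nlinarith [sq_nonneg (z - θ)]
      have h2 : nphi (z - θ) / nPhi θ ≤ (Real.sqrt (2 * Real.pi))⁻¹ / nPhi 0 :=
        div_le_div₀ hs.le h1 hP (nPhi_mono hθ)
      have : 0 < 1 / z := by positivity
      linarith
    · push Not at hθ
      have h1 : nphi (z - θ) = nphi θ * Real.exp (-z^2/2 + z * θ) := by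
        unfold nphi
        rw [mul_assoc, ← Real.exp_add]; congr 2; ring
      have h2 : nphi (z - θ) / nPhi θ = mills θ * Real.exp (-z^2/2 + z * θ) := by
        rw [h1, mills]; ring
      have h3 := mills_le θ
      rw [abs_of_neg hθ] at h3
      have h4 : Real.exp (-z^2/2 + z * θ) ≤ Real.exp (z * θ) :=
        Real.exp_le_exp.2 (by nlinarith [sq_nonneg z])
      have h5 : Real.exp (z * θ) ≤ 1 := Real.exp_le_one_iff.2 (by nlinarith)
      have h6 : (z * -θ) * Real.exp (z * θ) ≤ 1 := by
        have h := Real.add_one_le_exp (z * -θ)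
        have h' : Real.exp (z * -θ) * Real.exp (z * θ) = 1 := by
          rw [← Real.exp_add]; simp
        rw [← h']
        exact mul_le_mul_of_nonneg_right (by linarith) (Real.exp_pos _).le
      have h7 : -θ * Real.exp (z * θ) ≤ 1 / z := by
        rw [le_div_iff₀ hz]; linarith
      have h8 : 0 < (Real.sqrt (2 * Real.pi))⁻¹ / nPhi 0 := by positivity
      have h9 : mills θ * Real.exp (-z^2/2 + z * θ) ≤ (-θ + 1) * Real.exp (z * θ) :=
        mul_le_mul h3 h4 (Real.exp_pos _).le (by linarith)
      rw [h2]; linarith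
  · exact ⟨0, fun θ => by simp [tn, hz]⟩

lemma tn_bdd (b : Bool) (z : ℝ) : ∃ C, ∀ θ, tn θ b z ≤ C := by
  cases b
  · obtain ⟨C, hC⟩ := tnt_bdd (-z)
    exact ⟨C, fun θ => by rw [tn_false]; exact hC _⟩
  · exact tnt_bdd z

lemma tn_meas (b : Bool) : Measurable (fun x : ℝ × ℝ => tn x.1 b x.2) := by
  have h1 := nphi_cont.measurable
  have h2 := nPhi_cont.measurable
  unfold tn
  cases b
  · simp only [Bool.false_eq_true, if_false]
    refine Measurable.ite (measurableSet_lt measurable_snd measurable_const) ?_ measurable_const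
    exact (h1.comp (by fun_prop)).div (measurable_const.sub (h2.comp measurable_fst))
  · simp only [if_true]
    refine Measurable.ite (measurableSet_lt measurable_const measurable_snd) ?_ measurable_const
    exact (h1.comp (by fun_prop)).div (h2.comp measurable_fst)

/-! ### Quadratic moments of product densities -/

lemma quad_prod {m : ℕ} (f : Fin m → ℝ → ℝ) (c a s : Fin m → ℝ) (M : Matrix (Fin m) (Fin m) ℝ)
    (h0 : ∀ i, Integrable (f i)) (h0' : ∀ i, ∫ x, f i x = 1)
    (h1 : ∀ i, Integrable fun x => (x - c i) * f i x) (h1' : ∀ i, ∫ x, (x - c i) * f i x = a i)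
    (h2 : ∀ i, Integrable fun x => (x - c i) ^ 2 * f i x)
    (h2' : ∀ i, ∫ x, (x - c i) ^ 2 * f i x = s i) :
    Integrable (fun x : Fin m → ℝ => dotProduct (x - c) (M.mulVec (x - c)) * ∏ i, f i (x i)) ∧
    ∫ x : Fin m → ℝ, dotProduct (x - c) (M.mulVec (x - c)) * ∏ i, f i (x i)
      = dotProduct a (M.mulVec a) + ∑ i, M i i * (s i - a i ^ 2) := by
  classical
  let g : Fin m → Fin m → Fin m → ℝ → ℝ := fun i j k x =>
    (if k = i then x - c k else 1) * (if k = j then x - c k else 1) * f k x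
  have hg : ∀ i j (x : Fin m → ℝ), (x i - c i) * (x j - c j) * ∏ k, f k (x k) = ∏ k, g i j k (x k) := by
    intro i j x
    simp only [g, Finset.prod_mul_distrib, Finset.prod_ite_eq', Finset.mem_univ, if_true]
  have hgi : ∀ i j k, Integrable (g i j k) := by
    intro i j k
    simp only [g]
    by_cases hi : k = i <;> by_cases hj : k = j
    · simp only [hi, hj, if_true]
      have := h2 k
      subst hi; subst hj
      simpa [sq] using this
    · simp only [hi, hj, if_true, if_false]
      have := h1 k
      subst hi
      simpa [hj] using this
    · simp only [hi, hj, if_true, if_false]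
      have := h1 k
      subst hj
      simpa [hi] using this
    · simpa [hi, hj] using h0 k
  have hgint : ∀ i j k, ∫ x, g i j k x = if k = i then (if k = j then s k else a k)
      else (if k = j then a k else 1) := by
    intro i j k
    simp only [g]
    by_cases hi : k = i <;> by_cases hj : k = j
    · simp only [hi, hj, if_true]
      have := h2' k
      subst hi; subst hj
      simpa [sq] using this
    · simp only [hi, hj, if_true, if_false]
      have := h1' k
      subst hi
      simpa [hj] using this
    · simp only [hi, hj, if_true, if_false]
      have := h1' k
      subst hj
      simpa [hi] using this
    · simpa [hi, hj] using h0' k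
  have hI : ∀ i j, Integrable (fun x : Fin m → ℝ => (x i - c i) * (x j - c j) * ∏ k, f k (x k)) := by
    intro i j
    simp_rw [hg]
    exact Integrable.fintype_prod (fun k => hgi i j k)
  have hV : ∀ i j, ∫ x : Fin m → ℝ, (x i - c i) * (x j - c j) * ∏ k, f k (x k)
      = a i * a j + if i = j then s i - a i ^ 2 else 0 := by
    intro i j
    simp_rw [hg]
    rw [integral_fintype_prod_volume_eq_prod]
    simp_rw [hgint]
    by_cases hij : i = j
    · subst hij
      have : ∀ k, (if k = i then (if k = i then s k else a k) else (if k = i then a k else 1))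
        = if k = i then s k else 1 := by intro k; split_ifs <;> rfl
      simp_rw [this]
      simp; ring
    · have : ∀ k, (if k = i then (if k = j then s k else a k) else (if k = j then a k else 1))
        = (if k = i then a k else 1) * (if k = j then a k else 1) := by
        intro k
        by_cases hi : k = i
        · have : k ≠ j := fun h => hij (hi.symm.trans h)
          simp [hi, this, hij]
        · simp [hi]
      simp_rw [this]
      rw [Finset.prod_mul_distrib]
      simp [hij]
  have hexp : ∀ x : Fin m → ℝ, dotProduct (x - c) (M.mulVec (x - c)) * ∏ i, f i (x i)
      = ∑ i, ∑ j, M i j * ((x i - c i) * (x j - c j) * ∏ k, f k (x k)) := by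
    intro x
    simp only [dotProduct, mulVec, Finset.sum_mul, Finset.mul_sum, Pi.sub_apply]
    refine Finset.sum_congr rfl fun i _ => Finset.sum_congr rfl fun j _ => ?_
    ring
  simp_rw [hexp]
  constructor
  · exact integrable_finsetSum _ fun i _ => integrable_finsetSum _ fun j _ => (hI i j).const_mul _
  · refine (integral_finsetSum _ fun i _ =>
      integrable_finsetSum _ fun j _ => (hI i j).const_mul (M i j)).trans ?_
    have : ∀ i, ∫ x : Fin m → ℝ, ∑ j, M i j * ((x i - c i) * (x j - c j) * ∏ k, f k (x k))
        = ∑ j, M i j * (a i * a j + if i = j then s i - a i ^ 2 else 0) := by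
      intro i
      refine (integral_finsetSum _ fun j _ => (hI i j).const_mul (M i j)).trans ?_
      refine Finset.sum_congr rfl fun j _ => ?_
      rw [integral_const_mul, hV]
    simp_rw [this, mul_add, Finset.sum_add_distrib]
    congr 1
    · simp only [dotProduct, mulVec, Finset.mul_sum]
      refine Finset.sum_congr rfl fun i _ => Finset.sum_congr rfl fun j _ => ?_
      ring
    · simp

/-! ### The Gaussian density -/

open scoped MatrixOrder Matrix.Norms.L2Operator in
lemma exists_factor {p : ℕ} {S : Matrix (Fin p) (Fin p) ℝ} (hS : S.PosDef) :
    ∃ B : Matrix (Fin p) (Fin p) ℝ, S = Bᵀ * B ∧ B.det ≠ 0 := by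
  obtain ⟨B, hB⟩ := (CStarAlgebra.nonneg_iff_eq_star_mul_self (A := Matrix (Fin p) (Fin p) ℝ)).1 hS.posSemidef.nonneg
  refine ⟨B, ?_, ?_⟩
  · simpa [Matrix.star_eq_conjTranspose] using hB
  · intro h
    have := hS.det_pos
    rw [hB] at this
    simp [Matrix.star_eq_conjTranspose, h] at this

lemma mvn_eq {p : ℕ} (B : Matrix (Fin p) (Fin p) ℝ) (hB : B.det ≠ 0) (μ x : Fin p → ℝ) :
    mvn μ (Bᵀ * B)⁻¹ x = |B.det| * ∏ i, nphi (B.mulVec (x - μ) i) := by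
  have hdet : (Bᵀ * B).det = B.det ^ 2 := by rw [det_mul, det_transpose]; ring
  have hu : IsUnit (Bᵀ * B).det := by rw [hdet]; exact (pow_ne_zero 2 hB).isUnit
  unfold mvn
  rw [Matrix.nonsing_inv_nonsing_inv _ hu, Matrix.det_nonsing_inv, hdet]
  have e1 : dotProduct (x - μ) ((Bᵀ * B).mulVec (x - μ)) = ∑ i, (B.mulVec (x - μ) i) ^ 2 := by
    rw [← mulVec_mulVec, dotProduct_mulVec, vecMul_transpose]
    simp [dotProduct, sq]
  rw [e1]
  simp only [nphi, Finset.prod_mul_distrib, Finset.prod_const, Finset.card_univ, Fintype.card_fin]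
  rw [← Real.exp_sum, ← mul_assoc]
  congr 1
  · rw [Ring.inverse_eq_inv', mul_inv, inv_inv, Real.sqrt_mul (by positivity), Real.sqrt_sq_eq_abs, mul_comm,
      Real.sqrt_inv, inv_pow]
    congr 2
    rw [Real.sqrt_eq_iff_mul_self_eq (by positivity) (by positivity), ← mul_pow,
      Real.mul_self_sqrt (by positivity)]
  · congr 1
    rw [← Finset.sum_div, Finset.sum_neg_distrib]

lemma mvn_change {p : ℕ} (B : Matrix (Fin p) (Fin p) ℝ) (hB : B.det ≠ 0) (μ : Fin p → ℝ)
    (G : (Fin p → ℝ) → ℝ) (hG : Integrable fun u => G u * ∏ i, nphi (u i)) :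
    Integrable (fun x => G (B.mulVec (x - μ)) * mvn μ (Bᵀ * B)⁻¹ x) ∧
    ∫ x, G (B.mulVec (x - μ)) * mvn μ (Bᵀ * B)⁻¹ x = ∫ u, G u * ∏ i, nphi (u i) := by
  set F : (Fin p → ℝ) → ℝ := fun u => |B.det| * (G u * ∏ i, nphi (u i)) with hF
  have hFi : Integrable F := hG.const_mul _
  have hmap := Real.map_matrix_volume_pi_eq_smul_volume_pi hB
  have hFm : Integrable F (Measure.map (toLin' B) volume) := by
    rw [hmap]; exact hFi.smul_measure ENNReal.ofReal_ne_top
  have hmeas : Measurable (toLin' B) := (toLin' B).continuous_of_finiteDimensional.measurable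
  have e : (fun x => G (B.mulVec (x - μ)) * mvn μ (Bᵀ * B)⁻¹ x)
      = fun x => (fun y => F (toLin' B y)) (x - μ) := by
    funext x
    simp only [hF, toLin'_apply, mvn_eq B hB]
    ring
  rw [e]
  constructor
  · exact (hFm.comp_measurable hmeas).comp_sub_right μ
  · rw [integral_sub_right_eq_self (fun y => F (toLin' B y)) μ,
      ← integral_map hmeas.aemeasurable hFm.aestronglyMeasurable, hmap, integral_smul_measure,
      hF, integral_const_mul, ENNReal.toReal_ofReal (abs_nonneg _), smul_eq_mul, abs_inv, ← mul_assoc,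
      inv_mul_cancel₀ (abs_ne_zero.2 hB), one_mul]

lemma nphi_moments (c : ℝ) :
    Integrable (fun x => (x - c) * nphi x) ∧ ∫ x, (x - c) * nphi x = -c ∧
    Integrable (fun x => (x - c) ^ 2 * nphi x) ∧ ∫ x, (x - c) ^ 2 * nphi x = 1 + c ^ 2 := by
  have h1 := shift_int1c 0 c
  have h2 := shift_int2 0 c
  simp only [sub_zero] at h1 h2
  refine ⟨h1, ?_, h2, ?_⟩
  · have : ∀ x, (x - c) * nphi x = x * nphi x - c * nphi x := by intro x; ring
    simp_rw [this]
    rw [integral_sub nphi_int1 (nphi_int.const_mul _), integral_const_mul, nphi_integral,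
      nphi_integral1]
    ring
  · have : ∀ x, (x - c) ^ 2 * nphi x = x ^ 2 * nphi x + (-(2 * c) * (x * nphi x) + c ^ 2 * nphi x) := by
      intro x; ring
    simp_rw [this]
    have hI : Integrable (fun x => -(2 * c) * (x * nphi x) + c ^ 2 * nphi x) :=
      (nphi_int1.const_mul _).add (nphi_int.const_mul _)
    rw [integral_add nphi_int2 hI, integral_add (nphi_int1.const_mul _) (nphi_int.const_mul _),
      integral_const_mul, integral_const_mul, nphi_integral, nphi_integral1, nphi_integral2]
    ring

lemma mvn_nonneg {p : ℕ} (μ : Fin p → ℝ) (S : Matrix (Fin p) (Fin p) ℝ) (x : Fin p → ℝ) :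
    0 ≤ mvn μ S x := by unfold mvn; positivity

lemma mvn_cont {p : ℕ} (μ : Fin p → ℝ) (S : Matrix (Fin p) (Fin p) ℝ) : Continuous (mvn μ S) := by
  unfold mvn
  fun_prop

lemma mvn_mass {p : ℕ} {S : Matrix (Fin p) (Fin p) ℝ} (hS : S.PosDef) (μ : Fin p → ℝ) :
    Integrable (mvn μ S⁻¹) ∧ ∫ x, mvn μ S⁻¹ x = 1 := by
  obtain ⟨B, rfl, hB⟩ := exists_factor hS
  have hi : Integrable (fun u : Fin p → ℝ => ∏ i, nphi (u i)) :=
    Integrable.fintype_prod (fun _ => nphi_int)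
  have := mvn_change B hB μ (fun _ => 1) (by simpa using hi)
  simp only [one_mul] at this
  refine ⟨this.1, this.2.trans ?_⟩
  rw [integral_fintype_prod_volume_eq_prod (fun _ => nphi)]
  simp [nphi_integral]

/-- second moments of a Gaussian: `E ‖X(β - b)‖² = ‖X(μ - b)‖² + tr(X Σ⁻¹ Xᵀ)`. -/
lemma mvn_second {n p : ℕ} {S : Matrix (Fin p) (Fin p) ℝ} (hS : S.PosDef) (μ b : Fin p → ℝ)
    (X : Matrix (Fin n) (Fin p) ℝ) :
    Integrable (fun x => normSq (X.mulVec (x - b)) * mvn μ S⁻¹ x) ∧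
    ∫ x, normSq (X.mulVec (x - b)) * mvn μ S⁻¹ x
      = normSq (X.mulVec (μ - b)) + (X * S⁻¹ * Xᵀ).trace := by
  obtain ⟨B, rfl, hB⟩ := exists_factor hS
  have hBu : IsUnit B.det := hB.isUnit
  set A := X * B⁻¹ with hA
  set c : Fin p → ℝ := -(B.mulVec (μ - b)) with hc
  have hAB : A * B = X := by rw [hA, Matrix.mul_assoc, nonsing_inv_mul _ hBu, Matrix.mul_one]
  have hn : ∀ y : Fin p → ℝ, dotProduct y ((Aᵀ * A).mulVec y) = normSq (A.mulVec y) := by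
    intro y
    rw [← mulVec_mulVec, dotProduct_mulVec, vecMul_transpose]
    simp [normSq, dotProduct, sq]
  have hq := quad_prod (fun _ : Fin p => nphi) c (-c) (fun i => 1 + c i ^ 2) (Aᵀ * A)
    (fun _ => nphi_int) (fun _ => nphi_integral) (fun i => (nphi_moments (c i)).1)
    (fun i => (nphi_moments (c i)).2.1) (fun i => (nphi_moments (c i)).2.2.1)
    (fun i => (nphi_moments (c i)).2.2.2)
  simp_rw [hn] at hq
  have key := mvn_change B hB μ (fun u => normSq (A.mulVec (u - c))) hq.1
  have e : ∀ x, A.mulVec (B.mulVec (x - μ) - c) = X.mulVec (x - b) := by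
    intro x
    rw [hc, sub_neg_eq_add, ← mulVec_add, mulVec_mulVec, hAB]
    congr 1; abel
  simp_rw [e] at key
  refine ⟨key.1, key.2.trans (hq.2.trans ?_)⟩
  congr 1
  · rw [hc, neg_neg, mulVec_mulVec, hAB]
  · have : (X * (Bᵀ * B)⁻¹ * Xᵀ) = A * Aᵀ := by
      rw [Matrix.mul_inv_rev, hA, transpose_mul, transpose_nonsing_inv]
      simp only [Matrix.mul_assoc]
    rw [this, trace_mul_comm]
    simp [trace]

/-! ### Linear algebra -/

lemma normSq_eq_dot {m : ℕ} (x : Fin m → ℝ) : normSq x = dotProduct x x := by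
  simp [normSq, dotProduct, sq]

lemma normSq_nonneg {m : ℕ} (x : Fin m → ℝ) : 0 ≤ normSq x :=
  Finset.sum_nonneg fun _ _ => sq_nonneg _

lemma sig_posDef {n p : ℕ} (X : Matrix (Fin n) (Fin p) ℝ) (Q : Matrix (Fin p) (Fin p) ℝ)
    (hQ : Q.PosSemidef) (hSig : IsUnit (Xᵀ * X + Q).det) : (Xᵀ * X + Q).PosDef := by
  have h1 : (Xᵀ * X + Q).PosSemidef := by
    have := posSemidef_conjTranspose_mul_self X
    rw [conjTranspose_eq_transpose_of_trivial] at this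
    exact this.add hQ
  refine PosDef.of_dotProduct_mulVec_pos h1.1 fun x hx => ?_
  refine lt_of_le_of_ne (h1.dotProduct_mulVec_nonneg x) fun h => hx ?_
  have h2 := (h1.dotProduct_mulVec_zero_iff x).1 h.symm
  have := congrArg (fun y => (Xᵀ * X + Q)⁻¹.mulVec y) h2
  simpa [mulVec_mulVec, nonsing_inv_mul _ hSig] using this

lemma H_posDef {n p : ℕ} (X : Matrix (Fin n) (Fin p) ℝ) (S : Matrix (Fin p) (Fin p) ℝ)
    (hS : S.PosDef) (hrank : X.rank = n) : (X * S⁻¹ * Xᵀ).PosDef := by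
  have hli : LinearIndependent ℝ X.row := by
    rw [linearIndependent_iff_card_eq_finrank_span, Set.finrank, ← X.rank_eq_finrank_span_row,
      hrank, Fintype.card_fin]
  have := hS.inv.mul_mul_conjTranspose_same (Matrix.vecMul_injective_iff.2 hli)
  rwa [conjTranspose_eq_transpose_of_trivial] at this

lemma rayleigh_le {m : ℕ} (M : Matrix (Fin m) (Fin m) ℝ) (x : Fin m → ℝ) :
    dotProduct x (M.mulVec x) ≤ lmax M * normSq x := by
  by_cases hx : x = 0
  · subst hx; simp [normSq]
  have hpos : ∀ y : Fin m → ℝ, y ≠ 0 → 0 < normSq y := by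
    intro y hy
    refine lt_of_le_of_ne (normSq_nonneg y) fun h => hy ?_
    rw [normSq_eq_dot] at h
    exact dotProduct_self_eq_zero.1 h.symm
  have hb : BddAbove {r : ℝ | ∃ x : Fin m → ℝ, x ≠ 0 ∧ r = dotProduct x (M.mulVec x) / normSq x} := by
    refine ⟨∑ i, ∑ j, |M i j|, ?_⟩
    rintro r ⟨y, hy, rfl⟩
    rw [div_le_iff₀ (hpos y hy)]
    simp only [dotProduct, mulVec, Finset.mul_sum, Finset.sum_mul]
    refine Finset.sum_le_sum fun i _ => Finset.sum_le_sum fun j _ => ?_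
    have h1 : y i ^ 2 ≤ normSq y :=
      Finset.single_le_sum (f := fun i => y i ^ 2) (fun i _ => sq_nonneg (y i)) (Finset.mem_univ i)
    have h2 : y j ^ 2 ≤ normSq y :=
      Finset.single_le_sum (f := fun i => y i ^ 2) (fun i _ => sq_nonneg (y i)) (Finset.mem_univ j)
    have h3 : |y i * y j| ≤ normSq y := by
      rw [abs_le]; constructor <;> nlinarith [sq_nonneg (y i + y j), sq_nonneg (y i - y j)]
    calc y i * (M i j * y j) = M i j * (y i * y j) := by ring
      _ ≤ |M i j * (y i * y j)| := le_abs_self _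
      _ = |M i j| * |y i * y j| := abs_mul _ _
      _ ≤ |M i j| * normSq y := mul_le_mul_of_nonneg_left h3 (abs_nonneg _)
  rw [← div_le_iff₀ (hpos x hx)]
  exact le_csSup hb ⟨x, hx, rfl⟩

lemma diag_le_lmax {m : ℕ} (M : Matrix (Fin m) (Fin m) ℝ) (i : Fin m) : M i i ≤ lmax M := by
  have := rayleigh_le M (Pi.single i 1)
  have e : normSq (Pi.single i (1:ℝ)) = 1 := by
    rw [normSq_eq_dot]; simp
  rw [e] at this
  simpa using this

lemma sq_le_lmax {m : ℕ} (M : Matrix (Fin m) (Fin m) ℝ) (hM : M.PosDef) (hl : 0 < lmax M)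
    (u : Fin m → ℝ) : normSq (M.mulVec u) ≤ lmax M * dotProduct u (M.mulVec u) := by
  set y := M.mulVec u with hy
  have hT : Mᵀ = M := by
    have := hM.1
    rwa [IsHermitian, conjTranspose_eq_transpose_of_trivial] at this
  have h1 := hM.posSemidef.dotProduct_mulVec_nonneg (u - (lmax M)⁻¹ • y)
  have h2 := rayleigh_le M y
  have h3 : dotProduct u (M.mulVec y) = normSq y := by
    rw [dotProduct_mulVec, ← mulVec_transpose, hT, normSq_eq_dot]
  have h4 : dotProduct y (M.mulVec u) = normSq y := by rw [normSq_eq_dot]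
  simp only [star_trivial, mulVec_sub, mulVec_smul, sub_dotProduct, dotProduct_sub, smul_dotProduct,
    dotProduct_smul, smul_eq_mul, h3, h4] at h1
  rw [← hy] at h1
  have h5 : (lmax M)⁻¹ * ((lmax M)⁻¹ * dotProduct y (M.mulVec y)) ≤ (lmax M)⁻¹ * normSq y := by
    refine mul_le_mul_of_nonneg_left ?_ (inv_pos.2 hl).le
    rw [inv_mul_le_iff₀ hl]; exact h2
  have h6 : (lmax M)⁻¹ * normSq y ≤ dotProduct u y := by linarith
  rwa [inv_mul_le_iff₀ hl] at h6

lemma mode_eq {n p : ℕ} (X : Matrix (Fin n) (Fin p) ℝ) (Y : Fin n → Bool)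
    (v : Fin p → ℝ) (Q : Matrix (Fin p) (Fin p) ℝ) (hSig : IsUnit (Xᵀ * X + Q).det)
    (Bhat : Fin p → ℝ) (hmode : IsPosteriorMode X Y v Q Bhat) (z : Fin n → ℝ) :
    (Xᵀ * X + Q)⁻¹.mulVec (Xᵀ.mulVec z + Q.mulVec v) - Bhat
      = (Xᵀ * X + Q)⁻¹.mulVec (Xᵀ.mulVec (z - fun i => emn (dotProduct (X i) Bhat) (Y i))) := by
  set e0 : Fin n → ℝ := fun i => emn (dotProduct (X i) Bhat) (Y i) with he0
  have h1 : (Xᵀ * X + Q).mulVec Bhat = Xᵀ.mulVec e0 + Q.mulVec v := by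
    have hm := hmode
    unfold IsPosteriorMode at hm
    have hg : ∀ i, (if Y i then nphi (dotProduct (X i) Bhat) / nPhi (dotProduct (X i) Bhat)
          else -(nphi (dotProduct (X i) Bhat) / (1 - nPhi (dotProduct (X i) Bhat))))
          = (e0 - X.mulVec Bhat) i := by
      intro i
      have : X.mulVec Bhat i = dotProduct (X i) Bhat := rfl
      simp only [Pi.sub_apply, this, he0, emn, mills, nPhi_neg, nphi_neg]
      cases Y i <;> simp
    simp_rw [hg] at hm
    have h2 : (∑ i, (e0 - X.mulVec Bhat) i • X i) = Xᵀ.mulVec (e0 - X.mulVec Bhat) := by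
      funext j
      simp only [Finset.sum_apply, Pi.smul_apply, smul_eq_mul, mulVec, dotProduct, transpose_apply]
      exact Finset.sum_congr rfl fun i _ => mul_comm _ _
    rw [h2, mulVec_sub, mulVec_sub] at hm
    rw [add_mulVec, ← mulVec_mulVec]
    have := sub_eq_zero.1 hm
    rw [sub_eq_sub_iff_add_eq_add] at this
    rw [this]; abel
  have h3 : Bhat = (Xᵀ * X + Q)⁻¹.mulVec (Xᵀ.mulVec e0 + Q.mulVec v) := by
    rw [← h1, mulVec_mulVec, nonsing_inv_mul _ hSig, one_mulVec]
  conv_lhs => rw [h3]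
  rw [← mulVec_sub, mulVec_sub Xᵀ]
  congr 1; abel

/-! ### The truncated normal product kernel -/

/-- the conditional density of z' given β -/
def tker {n p : ℕ} (X : Matrix (Fin n) (Fin p) ℝ) (Y : Fin n → Bool) (z' : Fin n → ℝ)
    (β : Fin p → ℝ) : ℝ := ∏ i, tn (dotProduct (X i) β) (Y i) (z' i)

section tker
variable {n p : ℕ} (X : Matrix (Fin n) (Fin p) ℝ) (Y : Fin n → Bool)

lemma tker_nonneg (z' : Fin n → ℝ) (β : Fin p → ℝ) : 0 ≤ tker X Y z' β :=
  Finset.prod_nonneg fun _ _ => tn_nonneg _ _ _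

lemma tker_meas : Measurable (fun x : (Fin n → ℝ) × (Fin p → ℝ) => tker X Y x.1 x.2) := by
  unfold tker
  refine Finset.measurable_prod _ fun i _ => ?_
  have h : Measurable fun x : (Fin n → ℝ) × (Fin p → ℝ) => (dotProduct (X i) x.2, x.1 i) := by
    refine Measurable.prodMk ?_ (by fun_prop)
    have : Continuous fun x : (Fin n → ℝ) × (Fin p → ℝ) => dotProduct (X i) x.2 := by
      simp only [dotProduct]; fun_prop
    exact this.measurable
  exact (tn_meas (Y i)).comp h

lemma tker_bdd (z' : Fin n → ℝ) : ∃ C, ∀ β, tker X Y z' β ≤ C := by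
  choose C hC using fun i => tn_bdd (Y i) (z' i)
  exact ⟨∏ i, C i, fun β => Finset.prod_le_prod (fun _ _ => tn_nonneg _ _ _) fun i _ => hC i _⟩

lemma tker_mass (β : Fin p → ℝ) : Integrable (fun z' => tker X Y z' β) ∧ ∫ z', tker X Y z' β = 1 := by
  constructor
  · exact Integrable.fintype_prod fun i => (tn_moments (dotProduct (X i) β) (Y i) 0).1
  · unfold tker
    rw [integral_fintype_prod_volume_eq_prod fun i => tn (dotProduct (X i) β) (Y i)]
    exact Finset.prod_eq_one fun i _ => (tn_moments (dotProduct (X i) β) (Y i) 0).2.1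

lemma tker_mul_int (z' : Fin n → ℝ) (g : (Fin p → ℝ) → ℝ) (hg : Integrable g) :
    Integrable fun β => tker X Y z' β * g β := by
  obtain ⟨C, hC⟩ := tker_bdd X Y z'
  refine hg.bdd_mul (c := C) ?_ ?_
  · exact ((tker_meas X Y).comp (measurable_const.prodMk measurable_id)).aestronglyMeasurable
  · refine Eventually.of_forall fun β => ?_
    rw [Real.norm_eq_abs, abs_of_nonneg (tker_nonneg X Y z' β)]
    exact hC β

lemma mix_integral (g : (Fin p → ℝ) → ℝ) (hg : Integrable g) (h0 : ∀ β, 0 ≤ g β)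
    (hm : Measurable g) : ∫ z', ∫ β, tker X Y z' β * g β = ∫ β, g β := by
  have hI : Integrable (Function.uncurry fun (z' : Fin n → ℝ) (β : Fin p → ℝ) => tker X Y z' β * g β)
      (volume.prod volume) := by
    have hmeas : Measurable
        (Function.uncurry fun (z' : Fin n → ℝ) (β : Fin p → ℝ) => tker X Y z' β * g β) :=
      (tker_meas X Y).mul (hm.comp measurable_snd)
    rw [integrable_prod_iff' hmeas.aestronglyMeasurable]
    constructor
    · exact Eventually.of_forall fun β => (tker_mass X Y β).1.mul_const (g β)
    · refine hg.congr (Eventually.of_forall fun β => ?_)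
      have : ∀ z' : Fin n → ℝ, ‖Function.uncurry (fun (z' : Fin n → ℝ) (β : Fin p → ℝ) =>
          tker X Y z' β * g β) (z', β)‖ = tker X Y z' β * g β := fun z' =>
        Real.norm_of_nonneg (mul_nonneg (tker_nonneg X Y z' β) (h0 β))
      simp_rw [this]
      rw [integral_mul_const, (tker_mass X Y β).2, one_mul]
  rw [integral_integral_swap hI]
  congr 1; funext β
  rw [integral_mul_const, (tker_mass X Y β).2, one_mul]

/-- conditional second moment of `z' - c` in a quadratic form with PSD matrix -/
lemma tker_quad (M : Matrix (Fin n) (Fin n) ℝ) (hM : M.PosSemidef) (b β : Fin p → ℝ) :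
    Integrable (fun z' : Fin n → ℝ =>
      dotProduct (z' - fun i => emn (dotProduct (X i) b) (Y i))
        (M.mulVec (z' - fun i => emn (dotProduct (X i) b) (Y i))) * tker X Y z' β) ∧
    ∫ z' : Fin n → ℝ, dotProduct (z' - fun i => emn (dotProduct (X i) b) (Y i))
        (M.mulVec (z' - fun i => emn (dotProduct (X i) b) (Y i))) * tker X Y z' β
      ≤ lmax M * normSq (X.mulVec (β - b)) + n * lmax M := by
  set c : Fin n → ℝ := fun i => emn (dotProduct (X i) b) (Y i) with hc
  set a : Fin n → ℝ := fun i => emn (dotProduct (X i) β) (Y i) - c i with ha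
  have hmo := fun i => tn_moments (dotProduct (X i) β) (Y i) (c i)
  have hq := quad_prod (fun i => tn (dotProduct (X i) β) (Y i)) c a _ M
    (fun i => (hmo i).1) (fun i => (hmo i).2.1) (fun i => (hmo i).2.2.1)
    (fun i => (hmo i).2.2.2.1) (fun i => (hmo i).2.2.2.2.1) (fun i => rfl)
  refine ⟨hq.1, hq.2.le.trans ?_⟩
  have hd : ∀ i, 0 ≤ M i i := fun i => hM.diag_nonneg
  refine add_le_add ((rayleigh_le M a).trans ?_) ?_
  · have hlen : normSq a ≤ normSq (X.mulVec (β - b)) := by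
      refine Finset.sum_le_sum fun i _ => ?_
      rw [sq_le_sq]
      have := em_lip (dotProduct (X i) β) (dotProduct (X i) b) (Y i)
      rw [← dotProduct_sub] at this
      exact this
    rcases Nat.eq_zero_or_pos n with h | h
    · subst h; simp [normSq]
    · exact mul_le_mul_of_nonneg_left hlen ((hd ⟨0, h⟩).trans (diag_le_lmax M _))
  · have : ∀ i, M i i * ((∫ x, (x - c i) ^ 2 * tn (dotProduct (X i) β) (Y i) x) - a i ^ 2) ≤ lmax M := by
      intro i
      refine le_trans (mul_le_of_le_one_right (hd i) ?_) (diag_le_lmax M i)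
      have := (hmo i).2.2.2.2.2
      simp only [ha]; linarith
    refine (Finset.sum_le_sum fun i _ => this i).trans ?_
    simp

end tker

/-! ### Drift -/

lemma drift_aux {n p : ℕ} (hn : 1 ≤ n)
    (X : Matrix (Fin n) (Fin p) ℝ) (Y : Fin n → Bool)
    (v : Fin p → ℝ) (Q : Matrix (Fin p) (Fin p) ℝ) (hQ : Q.PosSemidef)
    (hSig : IsUnit (Xᵀ * X + Q).det) (hrank : X.rank = n)
    (Bhat : Fin p → ℝ) (hmode : IsPosteriorMode X Y v Q Bhat)
    (R : Matrix (Fin n) (Fin n) ℝ) (hR : R.PosSemidef)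
    (hRR : R * R = (X * (Xᵀ * X + Q)⁻¹ * Xᵀ)⁻¹)
    (lam : ℝ) (hlamdef : lam = (lmax (X * (Xᵀ * X + Q)⁻¹ * Xᵀ)) ^ 2) (hlam : lam < 1)
    (L : ℝ) (hL : L = n * (1 + lam)) (z : Fin n → ℝ) :
      (∫ z' : Fin n → ℝ, normSq (wfun X v Q R Bhat z') * kACflip X Y v Q z z')
        ≤ lam * normSq (wfun X v Q R Bhat z) + L := by
  have hS := sig_posDef X Q hQ hSig
  have hH := H_posDef X _ hS hrank
  set S := Xᵀ * X + Q with hSdef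
  set H := X * S⁻¹ * Xᵀ with hHdef
  set l := lmax H with hldef
  set e0 : Fin n → ℝ := fun i => emn (dotProduct (X i) Bhat) (Y i) with he0
  set m : Fin p → ℝ := S⁻¹.mulVec (Xᵀ.mulVec z + Q.mulVec v) with hm
  have hl : 0 < l := lt_of_lt_of_le (hH.diag_pos (i := ⟨0, hn⟩)) (diag_le_lmax H _)
  have hl1 : l < 1 := by
    rw [hlamdef] at hlam
    nlinarith
  have hRT : Rᵀ = R := by
    have := hR.1
    rwa [IsHermitian, conjTranspose_eq_transpose_of_trivial] at this
  have hHT : Hᵀ = H := by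
    have := hH.1
    rwa [IsHermitian, conjTranspose_eq_transpose_of_trivial] at this
  have hHu : IsUnit H.det := hH.det_pos.ne'.isUnit
  have hXm : ∀ u : Fin n → ℝ, X.mulVec (S⁻¹.mulVec (Xᵀ.mulVec u)) = H.mulVec u := by
    intro u; rw [mulVec_mulVec, mulVec_mulVec, ← hHdef]
  have hw : ∀ z', normSq (wfun X v Q R Bhat z') = dotProduct (z' - e0) (H.mulVec (z' - e0)) := by
    intro z'
    rw [wfun, mode_eq X Y v Q hSig Bhat hmode z', ← hSdef, hXm, ← he0, normSq_eq_dot,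
      dotProduct_mulVec, ← mulVec_transpose, hRT, mulVec_mulVec, hRR, mulVec_mulVec,
      nonsing_inv_mul _ hHu, one_mulVec, dotProduct_comm]
  have hV0 : ∀ z', 0 ≤ normSq (wfun X v Q R Bhat z') := fun z' => normSq_nonneg _
  have hXd : normSq (X.mulVec (m - Bhat)) ≤ l * normSq (wfun X v Q R Bhat z) := by
    rw [hw, hm, mode_eq X Y v Q hSig Bhat hmode z, ← hSdef, hXm]
    exact sq_le_lmax H hH hl _
  have htr : H.trace ≤ n * l := by
    have : ∑ i, H i i ≤ ∑ _i : Fin n, l := Finset.sum_le_sum fun i _ => diag_le_lmax H i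
    simpa [trace] using this
  have hsec := mvn_second hS m Bhat X
  have hmass := mvn_mass hS m
  -- the real upper bound
  set G : (Fin p → ℝ) → ℝ := fun β =>
    l * (normSq (X.mulVec (β - Bhat)) * mvn m S⁻¹ β) + n * l * mvn m S⁻¹ β with hG
  have hGi : Integrable G := (hsec.1.const_mul _).add (hmass.1.const_mul _)
  have hG0 : ∀ β, 0 ≤ G β := fun β => by
    have := mvn_nonneg m S⁻¹ β
    have := normSq_nonneg (X.mulVec (β - Bhat))
    simp only [hG]; positivity
  have hGint : ∫ β, G β ≤ lam * normSq (wfun X v Q R Bhat z) + L := by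
    simp only [hG]
    rw [integral_add (hsec.1.const_mul _) (hmass.1.const_mul _), integral_const_mul,
      integral_const_mul, hsec.2, hmass.2, hL, hlamdef]
    have h1 : l * (normSq (X.mulVec (m - Bhat)) + H.trace)
      ≤ l * (l * normSq (wfun X v Q R Bhat z) + n * l) :=
      mul_le_mul_of_nonneg_left (add_le_add hXd htr) hl.le
    have h2 : (n : ℝ) * l ≤ n * 1 := mul_le_mul_of_nonneg_left hl1.le (Nat.cast_nonneg n)
    nlinarith
  -- Tonelli
  have hT0 : ∀ z' β, 0 ≤ tker X Y z' β * mvn m S⁻¹ β := fun z' β =>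
    mul_nonneg (tker_nonneg X Y z' β) (mvn_nonneg _ _ _)
  have hk : ∀ z', kACflip X Y v Q z z' = ∫ β, tker X Y z' β * mvn m S⁻¹ β := fun z' => rfl
  have hk0 : ∀ z', 0 ≤ kACflip X Y v Q z z' := fun z' => by
    rw [hk]; exact integral_nonneg (hT0 z')
  have hVm : Measurable fun z' => normSq (wfun X v Q R Bhat z') := by
    have : Continuous fun z' => normSq (wfun X v Q R Bhat z') := by
      unfold normSq wfun; fun_prop
    exact this.measurable
  have hlin : ∫⁻ z', ENNReal.ofReal (normSq (wfun X v Q R Bhat z') * kACflip X Y v Q z z')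
      ≤ ENNReal.ofReal (∫ β, G β) := by
    have e1 : ∀ z', ENNReal.ofReal (normSq (wfun X v Q R Bhat z') * kACflip X Y v Q z z')
        = ∫⁻ β, ENNReal.ofReal (normSq (wfun X v Q R Bhat z') * (tker X Y z' β * mvn m S⁻¹ β)) := by
      intro z'
      rw [hk, ← integral_const_mul, ofReal_integral_eq_lintegral_ofReal]
      · exact (tker_mul_int X Y z' _ hmass.1).const_mul _
      · exact Eventually.of_forall fun β => mul_nonneg (hV0 z') (hT0 z' β)
    simp_rw [e1]
    rw [lintegral_lintegral_swap]
    · rw [ofReal_integral_eq_lintegral_ofReal hGi (Eventually.of_forall hG0)]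
      refine lintegral_mono fun β => ?_
      have hq := tker_quad X Y H hH.posSemidef Bhat β
      rw [← he0] at hq
      simp_rw [← hw] at hq
      have e2 : ∀ z', normSq (wfun X v Q R Bhat z') * (tker X Y z' β * mvn m S⁻¹ β)
        = (normSq (wfun X v Q R Bhat z') * tker X Y z' β) * mvn m S⁻¹ β := fun z' => by ring
      simp_rw [e2]
      rw [← ofReal_integral_eq_lintegral_ofReal (hq.1.mul_const _)]
      · apply ENNReal.ofReal_le_ofReal
        rw [integral_mul_const]
        refine (mul_le_mul_of_nonneg_right hq.2 (mvn_nonneg _ _ _)).trans (le_of_eq ?_)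
        simp only [hG]; ring
      · exact Eventually.of_forall fun z' =>
          mul_nonneg (mul_nonneg (hV0 z') (tker_nonneg X Y z' β)) (mvn_nonneg _ _ _)
    · refine Measurable.aemeasurable ?_
      refine ENNReal.measurable_ofReal.comp ?_
      exact (hVm.comp measurable_fst).mul
        ((tker_meas X Y).mul ((mvn_cont m S⁻¹).measurable.comp measurable_snd))
  refine le_trans ?_ hGint
  have h1 := norm_integral_le_lintegral_norm
    (μ := volume) (fun z' : Fin n → ℝ => normSq (wfun X v Q R Bhat z') * kACflip X Y v Q z z')
  have e3 : ∀ z' : Fin n → ℝ, ‖normSq (wfun X v Q R Bhat z') * kACflip X Y v Q z z'‖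
      = normSq (wfun X v Q R Bhat z') * kACflip X Y v Q z z' := fun z' =>
    Real.norm_of_nonneg (mul_nonneg (hV0 z') (hk0 z'))
  simp_rw [e3] at h1
  refine (Real.le_norm_self _).trans (h1.trans ?_)
  refine (ENNReal.toReal_mono ENNReal.ofReal_ne_top hlin).trans (le_of_eq ?_)
  exact ENNReal.toReal_ofReal (integral_nonneg hG0)

/-! ### Minorization -/

lemma minor_aux {n p : ℕ}
    (X : Matrix (Fin n) (Fin p) ℝ) (Y : Fin n → Bool)
    (v : Fin p → ℝ) (Q : Matrix (Fin p) (Fin p) ℝ) (hQ : Q.PosSemidef)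
    (hSig : IsUnit (Xᵀ * X + Q).det) (hrank : X.rank = n)
    (Bhat : Fin p → ℝ)
    (R : Matrix (Fin n) (Fin n) ℝ) (hR : R.PosSemidef)
    (hRR : R * R = (X * (Xᵀ * X + Q)⁻¹ * Xᵀ)⁻¹) (d : ℝ) :
      ∃ q : (Fin n → ℝ) → ℝ, (∀ z', 0 ≤ q z') ∧ (∫ z', q z') = 1 ∧
        ∀ z : Fin n → ℝ, normSq (wfun X v Q R Bhat z) ≤ d → ∀ z' : Fin n → ℝ,
          (2 : ℝ) ^ (-(n : ℝ) / 2) * Real.exp (-d) * q z' ≤ kACflip X Y v Q z z' := by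
  have hS := sig_posDef X Q hQ hSig
  have hH := H_posDef X _ hS hrank
  set S := Xᵀ * X + Q with hSdef
  set H := X * S⁻¹ * Xᵀ with hHdef
  have hHu : IsUnit H.det := hH.det_pos.ne'.isUnit
  have hRT : Rᵀ = R := by
    have := hR.1
    rwa [IsHermitian, conjTranspose_eq_transpose_of_trivial] at this
  have hST : Sᵀ = S := by
    have := hS.1
    rwa [IsHermitian, conjTranspose_eq_transpose_of_trivial] at this
  set S' := S + Xᵀ * H⁻¹ * X with hS'def
  have hS' : S'.PosDef := by
    have := hH.inv.posSemidef.conjTranspose_mul_mul_same X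
    rw [conjTranspose_eq_transpose_of_trivial] at this
    exact hS.add_posSemidef this
  have hdet : S'.det = 2 ^ n * S.det := by
    have e : S' = S * (1 + S⁻¹ * Xᵀ * (H⁻¹ * X)) := by
      rw [Matrix.mul_add, Matrix.mul_one, hS'def]
      congr 1
      rw [← Matrix.mul_assoc, ← Matrix.mul_assoc, ← Matrix.mul_assoc, mul_nonsing_inv _ hSig, Matrix.one_mul]
    have e2 : (1 : Matrix (Fin n) (Fin n) ℝ) + H⁻¹ * X * (S⁻¹ * Xᵀ) = (2:ℝ) • 1 := by
      rw [Matrix.mul_assoc, ← Matrix.mul_assoc X, ← hHdef, nonsing_inv_mul _ hHu, two_smul]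
    rw [e, det_mul, det_one_add_mul_comm, e2, det_smul]
    simp [mul_comm]
  have hmass' := mvn_mass hS' Bhat
  refine ⟨fun z' => ∫ β, tker X Y z' β * mvn Bhat S'⁻¹ β, ?_, ?_, ?_⟩
  · exact fun z' => integral_nonneg fun β => mul_nonneg (tker_nonneg X Y z' β) (mvn_nonneg _ _ _)
  · rw [mix_integral X Y _ hmass'.1 (mvn_nonneg _ _) (mvn_cont _ _).measurable, hmass'.2]
  · intro z hz z'
    set m : Fin p → ℝ := S⁻¹.mulVec (Xᵀ.mulVec z + Q.mulVec v) with hm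
    have hmass := mvn_mass hS m
    set δ := m - Bhat with hδ
    set w := R.mulVec (X.mulVec δ) with hw
    have hwz : wfun X v Q R Bhat z = w := rfl
    rw [hwz] at hz
    set δ' := S⁻¹.mulVec (Xᵀ.mulVec (H⁻¹.mulVec (X.mulVec δ))) with hδ'
    have hXδ' : X.mulVec δ' = X.mulVec δ := by
      rw [hδ', mulVec_mulVec _ X, mulVec_mulVec _ (X * S⁻¹), ← hHdef, mulVec_mulVec _ H,
        mul_nonsing_inv _ hHu, one_mulVec]
    have hSδ' : S.mulVec δ' = Xᵀ.mulVec (H⁻¹.mulVec (X.mulVec δ)) := by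
      rw [hδ', mulVec_mulVec, mul_nonsing_inv _ hSig, one_mulVec]
    have hHR : ∀ a b : Fin n → ℝ, dotProduct a (H⁻¹.mulVec b) = dotProduct (R.mulVec a) (R.mulVec b) := by
      intro a b
      rw [← hRR, ← mulVec_mulVec, dotProduct_mulVec, ← mulVec_transpose, hRT]
    have hyδ : ∀ y : Fin p → ℝ, dotProduct y (S.mulVec δ') = dotProduct (R.mulVec (X.mulVec y)) w := by
      intro y
      rw [hSδ', dotProduct_mulVec, vecMul_transpose, hHR]
    have hpt : ∀ β, (2 : ℝ) ^ (-(n : ℝ) / 2) * Real.exp (-d) * mvn Bhat S'⁻¹ β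
        ≤ mvn m S⁻¹ (β + (δ - δ')) := by
      intro β
      set y := β - Bhat with hy
      set r := R.mulVec (X.mulVec y) with hr
      have ey : β + (δ - δ') - m = y - δ' := by rw [hy, hδ]; abel
      have eq1 : dotProduct (y - δ') (S.mulVec (y - δ'))
          = dotProduct y (S.mulVec y) - 2 * dotProduct r w + dotProduct w w := by
        have h1 : dotProduct δ' (S.mulVec y) = dotProduct y (S.mulVec δ') := by
          rw [dotProduct_mulVec, ← mulVec_transpose, hST, dotProduct_comm]
        have h2 : dotProduct δ' (S.mulVec δ') = dotProduct w w := by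
          rw [hyδ, hXδ']
        rw [mulVec_sub, sub_dotProduct, dotProduct_sub, dotProduct_sub, h1, h2, hyδ]
        ring
      have eq2 : dotProduct y (S'.mulVec y) = dotProduct y (S.mulVec y) + dotProduct r r := by
        rw [hS'def, add_mulVec, dotProduct_add, ← mulVec_mulVec, ← mulVec_mulVec,
          dotProduct_mulVec y Xᵀ, vecMul_transpose, hHR]
      have hrw : 0 ≤ dotProduct r r + 2 * dotProduct r w + dotProduct w w := by
        have := normSq_nonneg (r + w)
        rw [normSq_eq_dot, add_dotProduct, dotProduct_add, dotProduct_add, dotProduct_comm w r] at this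
        linarith
      rw [normSq_eq_dot] at hz
      have hS'u : IsUnit S'.det := hS'.det_pos.ne'.isUnit
      unfold mvn
      have hinv : ∀ a b : ℝ, (a * b⁻¹)⁻¹ = a⁻¹ * b := fun a b => by rw [mul_inv, inv_inv]
      rw [nonsing_inv_nonsing_inv _ hSig, nonsing_inv_nonsing_inv _ hS'u, ey, eq1, eq2,
        det_nonsing_inv, det_nonsing_inv, hdet, Ring.inverse_eq_inv',
        hinv, hinv]
      have hc : Real.sqrt (((2 * Real.pi) ^ p)⁻¹ * (2 ^ n * S.det))
          = (2:ℝ) ^ ((n:ℝ)/2) * Real.sqrt (((2 * Real.pi) ^ p)⁻¹ * S.det) := by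
        rw [show ((2 * Real.pi) ^ p)⁻¹ * (2 ^ n * S.det)
          = 2 ^ n * (((2 * Real.pi) ^ p)⁻¹ * S.det) by ring, Real.sqrt_mul (by positivity)]
        congr 1
        rw [Real.sqrt_eq_rpow, ← Real.rpow_natCast, ← Real.rpow_mul (by norm_num)]
        congr 1; ring
      rw [hc]
      have h2 : (2:ℝ) ^ (-(n:ℝ)/2) * (2:ℝ) ^ ((n:ℝ)/2) = 1 := by
        rw [← Real.rpow_add (by norm_num)]
        rw [show -(n:ℝ)/2 + (n:ℝ)/2 = 0 by ring, Real.rpow_zero]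
      set K := Real.sqrt (((2 * Real.pi) ^ p)⁻¹ * S.det)
      have hK : 0 ≤ K := Real.sqrt_nonneg _
      set E := Real.exp (-(dotProduct y (S.mulVec y) + dotProduct r r) / 2)
      calc (2 : ℝ) ^ (-(n : ℝ) / 2) * Real.exp (-d) * ((2:ℝ) ^ ((n:ℝ)/2) * K * E)
          = ((2:ℝ) ^ (-(n:ℝ)/2) * (2:ℝ) ^ ((n:ℝ)/2)) * (K * (Real.exp (-d) * E)) := by ring
        _ = K * (Real.exp (-d) * E) := by rw [h2, one_mul]
        _ ≤ _ := by
          refine mul_le_mul_of_nonneg_left ?_ hK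
          rw [← Real.exp_add, Real.exp_le_exp]
          linarith
    have hk : kACflip X Y v Q z z' = ∫ β, tker X Y z' β * mvn m S⁻¹ (β + (δ - δ')) := by
      have h1 : kACflip X Y v Q z z' = ∫ β, tker X Y z' β * mvn m S⁻¹ β := rfl
      rw [h1, ← integral_add_right_eq_self _ (δ - δ')]
      congr 1; funext β
      congr 1
      unfold tker
      refine Finset.prod_congr rfl fun i _ => ?_
      congr 1
      have : X.mulVec (β + (δ - δ')) = X.mulVec β := by
        rw [mulVec_add, mulVec_sub, hXδ', sub_self, add_zero]
      exact congrFun this i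
    rw [hk, ← integral_const_mul]
    refine integral_mono ((tker_mul_int X Y z' _ hmass'.1).const_mul _)
      (tker_mul_int X Y z' _ (hmass.1.comp_add_right _)) fun β => ?_
    have := mul_le_mul_of_nonneg_left (hpt β) (tker_nonneg X Y z' β)
    refine le_trans (le_of_eq ?_) this
    ring

/-- drift and minorization for the flipped chain ǩ_AC on ℝⁿ with
drift function V̌₂(z) = ‖w(z)‖². -/
theorem drift_and_minorization_flipped_V2
    (n p : ℕ) (hn : 1 ≤ n) (hp : 1 ≤ p)
    (X : Matrix (Fin n) (Fin p) ℝ) (Y : Fin n → Bool)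
    (v : Fin p → ℝ) (Q : Matrix (Fin p) (Fin p) ℝ) (hQ : Q.PosSemidef)
    (hSig : IsUnit (Xᵀ * X + Q).det)
    (hrank : X.rank = n)
    (Bhat : Fin p → ℝ) (hmode : IsPosteriorMode X Y v Q Bhat)
    (R : Matrix (Fin n) (Fin n) ℝ) (hR : R.PosSemidef)
    (hRR : R * R = (X * (Xᵀ * X + Q)⁻¹ * Xᵀ)⁻¹)
    (lam : ℝ) (hlamdef : lam = (lmax (X * (Xᵀ * X + Q)⁻¹ * Xᵀ)) ^ 2) (hlam : lam < 1)
    (L : ℝ) (hL : L = n * (1 + lam)) :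
    (∀ z : Fin n → ℝ,
      (∫ z' : Fin n → ℝ, normSq (wfun X v Q R Bhat z') * kACflip X Y v Q z z')
        ≤ lam * normSq (wfun X v Q R Bhat z) + L) ∧
    (∀ d : ℝ, d > 2 * L / (1 - lam) →
      ∃ q : (Fin n → ℝ) → ℝ, (∀ z', 0 ≤ q z') ∧ (∫ z', q z') = 1 ∧
        ∀ z : Fin n → ℝ, normSq (wfun X v Q R Bhat z) ≤ d → ∀ z' : Fin n → ℝ,
          (2 : ℝ) ^ (-(n : ℝ) / 2) * Real.exp (-d) * q z' ≤ kACflip X Y v Q z z') := by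
  exact ⟨fun z => drift_aux hn X Y v Q hQ hSig hrank Bhat hmode R hR hRR lam hlamdef hlam L hL z,
    fun d _ => minor_aux X Y v Q hQ hSig hrank Bhat R hR hRR d⟩
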